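/- arXiv:2502.05501 — 3 statements merged into one kernel-verified Lean document; each statement's English description precedes it below -/
import Mathlib

section
/- Assume 1 − αR₁/μ ≥ 0. Then every Navier-admissible pair V = (v_r, v_θ) satisfies the four interpolation inequalities ‖∂_r v_r‖_{L²(Ω̃)}² ≤ ‖v_r‖_{L²(Ω̃)} ‖∂_{rr} v_r‖_{L²(Ω̃)}, ‖∂_θ v_r‖_{L²(Ω̃)}² ≤ ‖v_r‖_{L²(Ω̃)} ‖∂_{θθ} v_r‖_{L²(Ω̃)}, ‖∂_r v_θ‖_{L²(Ω̃)}² ≤ ‖v_θ‖_{L²(Ω̃)} ‖∂_{rr} v_θ‖_{L²(Ω̃)}, and ‖∂_θ v_θ‖_{L²(Ω̃)}² ≤ ‖v_θ‖_{L²(Ω̃)} ‖∂_{θθ} v_θ‖_{L²(Ω̃)}. -/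
open Real MeasureTheory Set

noncomputable section

/-- Partial derivative in the radial variable. -/
def pdr (f : ℝ → ℝ → ℝ) (r θ : ℝ) : ℝ := deriv (fun x => f x θ) r

/-- Partial derivative in the angular variable. -/
def pdt (f : ℝ → ℝ → ℝ) (r θ : ℝ) : ℝ := deriv (fun y => f r y) θ

/-- An admissible pair `V = (v_r, v_θ)`: smooth, `2π`-periodic in `θ`,
divergence free (`∂_r (r v_r) + ∂_θ v_θ = 0`), with `v_r` vanishing on both
boundary circles and `v_θ` vanishing on the outer one (the smooth version of
the space `G^{1,2}` of the paper). -/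
def Admissible (R₁ R₂ : ℝ) (vr vθ : ℝ → ℝ → ℝ) : Prop :=
  ContDiff ℝ (⊤ : ℕ∞) (fun p : ℝ × ℝ => vr p.1 p.2) ∧
  ContDiff ℝ (⊤ : ℕ∞) (fun p : ℝ × ℝ => vθ p.1 p.2) ∧
  (∀ r ∈ Icc R₁ R₂, ∀ θ : ℝ, vr r (θ + 2 * π) = vr r θ) ∧
  (∀ r ∈ Icc R₁ R₂, ∀ θ : ℝ, vθ r (θ + 2 * π) = vθ r θ) ∧
  (∀ r ∈ Icc R₁ R₂, ∀ θ : ℝ, deriv (fun x => x * vr x θ) r + pdt vθ r θ = 0) ∧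
  (∀ θ : ℝ, vr R₁ θ = 0) ∧ (∀ θ : ℝ, vr R₂ θ = 0) ∧ (∀ θ : ℝ, vθ R₂ θ = 0)

/-- The squared `L²(Ω̃)` norm of the gradient `∇̃V`. -/
def gradSq (R₁ R₂ : ℝ) (vr vθ : ℝ → ℝ → ℝ) : ℝ :=
  ∫ r in R₁..R₂, ∫ θ in (0:ℝ)..(2 * π),
    ((pdr vr r θ) ^ 2 + (pdt vr r θ) ^ 2 + (pdr vθ r θ) ^ 2 + (pdt vθ r θ) ^ 2)

/-- Second-order partial derivatives. -/
def pdrr (f : ℝ → ℝ → ℝ) : ℝ → ℝ → ℝ := pdr (pdr f)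
def pdtt (f : ℝ → ℝ → ℝ) : ℝ → ℝ → ℝ := pdt (pdt f)
def pdrt (f : ℝ → ℝ → ℝ) : ℝ → ℝ → ℝ := pdr (pdt f)

/-- A Navier-admissible pair: admissible, and in addition satisfying the Navier-slip
boundary condition `∂_r v_θ(R₁,θ) = (1/R₁ − α/μ) v_θ(R₁,θ)` (the smooth version of
the space `V^{1,2}` of the paper). -/
def NavierAdmissible (R₁ R₂ μ α : ℝ) (vr vθ : ℝ → ℝ → ℝ) : Prop :=
  Admissible R₁ R₂ vr vθ ∧ ∀ θ : ℝ, pdr vθ R₁ θ = (1 / R₁ - α / μ) * vθ R₁ θ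

/-- The `L²(Ω̃)` norm of a scalar function. -/
def nL2 (R₁ R₂ : ℝ) (f : ℝ → ℝ → ℝ) : ℝ :=
  Real.sqrt (∫ r in R₁..R₂, ∫ θ in (0:ℝ)..(2 * π), (f r θ) ^ 2)

theorem ContDiff.pdr {f : ℝ → ℝ → ℝ}
    (hf : ContDiff ℝ (⊤ : ℕ∞) (fun p : ℝ × ℝ => f p.1 p.2)) :
    ContDiff ℝ (⊤ : ℕ∞) (fun p : ℝ × ℝ => pdr f p.1 p.2) := by
  have h : (fun p : ℝ × ℝ => _root_.pdr f p.1 p.2) =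
      fun p => fderiv ℝ (fun p : ℝ × ℝ => f p.1 p.2) p (1, 0) := by
    funext p
    have h1 := (hf.differentiable (by simp) p).hasFDerivAt
    have h2 : HasDerivAt (fun x : ℝ => (x, p.2)) ((1 : ℝ), (0 : ℝ)) p.1 :=
      (hasDerivAt_id p.1).prodMk (hasDerivAt_const _ _)
    exact (h1.comp_hasDerivAt (f := fun x : ℝ => (x, p.2)) p.1 h2).deriv
  rw [h]
  exact (hf.fderiv_right (by simp)).clm_apply contDiff_const

theorem ContDiff.pdt {f : ℝ → ℝ → ℝ}
    (hf : ContDiff ℝ (⊤ : ℕ∞) (fun p : ℝ × ℝ => f p.1 p.2)) :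
    ContDiff ℝ (⊤ : ℕ∞) (fun p : ℝ × ℝ => pdt f p.1 p.2) := by
  have h : (fun p : ℝ × ℝ => _root_.pdt f p.1 p.2) =
      fun p => fderiv ℝ (fun p : ℝ × ℝ => f p.1 p.2) p (0, 1) := by
    funext p
    have h1 := (hf.differentiable (by simp) p).hasFDerivAt
    have h2 : HasDerivAt (fun y : ℝ => (p.1, y)) ((0 : ℝ), (1 : ℝ)) p.2 :=
      (hasDerivAt_const _ _).prodMk (hasDerivAt_id p.2)
    exact (h1.comp_hasDerivAt (f := fun y : ℝ => (p.1, y)) p.2 h2).deriv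
  rw [h]
  exact (hf.fderiv_right (by simp)).clm_apply contDiff_const

theorem ContDiff.hasDerivAt_pdr {f : ℝ → ℝ → ℝ}
    (hf : ContDiff ℝ (⊤ : ℕ∞) (fun p : ℝ × ℝ => f p.1 p.2)) (r θ : ℝ) :
    HasDerivAt (fun x => f x θ) (_root_.pdr f r θ) r := by
  have h : ContDiff ℝ (⊤ : ℕ∞) (fun x => f x θ) :=
    hf.comp (contDiff_id.prodMk contDiff_const)
  exact (h.differentiable (by simp) r).hasDerivAt

theorem ContDiff.hasDerivAt_pdt {f : ℝ → ℝ → ℝ}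
    (hf : ContDiff ℝ (⊤ : ℕ∞) (fun p : ℝ × ℝ => f p.1 p.2)) (r θ : ℝ) :
    HasDerivAt (fun y => f r y) (_root_.pdt f r θ) θ := by
  have h : ContDiff ℝ (⊤ : ℕ∞) (fun y => f r y) :=
    hf.comp (contDiff_const.prodMk contDiff_id)
  exact (h.differentiable (by simp) θ).hasDerivAt

theorem Continuous.intervalIntegral_snd {F : ℝ → ℝ → ℝ}
    (hF : Continuous (fun p : ℝ × ℝ => F p.1 p.2)) (c d : ℝ) :
    Continuous (fun r => ∫ θ in c..d, F r θ) :=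
  intervalIntegral.continuous_parametric_intervalIntegral_of_continuous' hF c d

theorem intervalIntegral_swap_of_continuous {F : ℝ → ℝ → ℝ}
    (hF : Continuous (fun p : ℝ × ℝ => F p.1 p.2)) (a b c d : ℝ) :
    ∫ r in a..b, ∫ θ in c..d, F r θ = ∫ θ in c..d, ∫ r in a..b, F r θ := by
  refine intervalIntegral_intervalIntegral_swap ?_
  exact (hF.continuousOn.integrableOn_compact (isCompact_uIcc.prod isCompact_uIcc)).mono_set
    (prod_mono uIoc_subset_uIcc uIoc_subset_uIcc)

/-- Cauchy–Schwarz inequality for iterated integrals of continuous functions over a rectangle. -/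
theorem sq_intervalIntegral_mul_le {a b c d : ℝ} (hab : a ≤ b) (hcd : c ≤ d)
    {f g : ℝ → ℝ → ℝ} (hf : Continuous (fun p : ℝ × ℝ => f p.1 p.2))
    (hg : Continuous (fun p : ℝ × ℝ => g p.1 p.2)) :
    (∫ r in a..b, ∫ θ in c..d, f r θ * g r θ) ^ 2 ≤
      (∫ r in a..b, ∫ θ in c..d, f r θ ^ 2) * ∫ r in a..b, ∫ θ in c..d, g r θ ^ 2 := by
  have quadratic : ∀ t : ℝ, 0 ≤ (∫ r in a..b, ∫ θ in c..d, g r θ ^ 2) * (t * t) +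
      (2 * ∫ r in a..b, ∫ θ in c..d, f r θ * g r θ) * t +
      ∫ r in a..b, ∫ θ in c..d, f r θ ^ 2 := by
    intro t
    have inner : ∀ r, ∫ θ in c..d, (f r θ + t * g r θ) ^ 2 =
        (∫ θ in c..d, g r θ ^ 2) * (t * t) + (∫ θ in c..d, f r θ * g r θ) * (2 * t) +
          ∫ θ in c..d, f r θ ^ 2 := by
      intro r
      have hfr : Continuous (f r) := hf.comp (Continuous.prodMk_right r)
      have hgr : Continuous (g r) := hg.comp (Continuous.prodMk_right r)
      rw [← intervalIntegral.integral_mul_const, ← intervalIntegral.integral_mul_const,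
        ← intervalIntegral.integral_add, ← intervalIntegral.integral_add]
      · congr 1
        funext θ
        ring
      all_goals exact Continuous.intervalIntegrable (by fun_prop) _ _
    have hgg := Continuous.intervalIntegral_snd (F := fun r θ => g r θ ^ 2) (hg.pow 2) c d
    have hff := Continuous.intervalIntegral_snd (F := fun r θ => f r θ ^ 2) (hf.pow 2) c d
    have hfg := Continuous.intervalIntegral_snd (F := fun r θ => f r θ * g r θ) (hf.mul hg) c d
    have outer : ∫ r in a..b, ∫ θ in c..d, (f r θ + t * g r θ) ^ 2 =
        (∫ r in a..b, ∫ θ in c..d, g r θ ^ 2) * (t * t) +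
          (∫ r in a..b, ∫ θ in c..d, f r θ * g r θ) * (2 * t) +
          ∫ r in a..b, ∫ θ in c..d, f r θ ^ 2 := by
      simp only [inner]
      rw [← intervalIntegral.integral_mul_const, ← intervalIntegral.integral_mul_const,
        ← intervalIntegral.integral_add, ← intervalIntegral.integral_add]
      all_goals exact Continuous.intervalIntegrable (by fun_prop) _ _
    have nonneg : 0 ≤ ∫ r in a..b, ∫ θ in c..d, (f r θ + t * g r θ) ^ 2 :=
      intervalIntegral.integral_nonneg hab fun r _ =>
        intervalIntegral.integral_nonneg hcd fun θ _ => sq_nonneg _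
    linarith
  have := discrim_le_zero quadratic
  rw [discrim] at this
  linarith

theorem nL2_sq_le_mul {R₁ R₂ : ℝ} (hR : R₁ ≤ R₂) {f g h : ℝ → ℝ → ℝ}
    (hf : Continuous (fun p : ℝ × ℝ => f p.1 p.2))
    (hh : Continuous (fun p : ℝ × ℝ => h p.1 p.2))
    (hle : (∫ r in R₁..R₂, ∫ θ in (0:ℝ)..(2 * π), g r θ ^ 2) ≤
      -∫ r in R₁..R₂, ∫ θ in (0:ℝ)..(2 * π), f r θ * h r θ) :
    nL2 R₁ R₂ g ^ 2 ≤ nL2 R₁ R₂ f * nL2 R₁ R₂ h := by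
  have nonneg : ∀ k : ℝ → ℝ → ℝ, 0 ≤ ∫ r in R₁..R₂, ∫ θ in (0:ℝ)..(2 * π), k r θ ^ 2 :=
    fun k => intervalIntegral.integral_nonneg hR fun r _ =>
      intervalIntegral.integral_nonneg two_pi_pos.le fun θ _ => sq_nonneg _
  rw [nL2, nL2, nL2, Real.sq_sqrt (nonneg g), ← Real.sqrt_mul (nonneg f)]
  refine Real.le_sqrt_of_sq_le ((pow_le_pow_left₀ (nonneg g) hle 2).trans ?_)
  rw [neg_sq]
  exact sq_intervalIntegral_mul_le hR two_pi_pos.le hf hh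

/-- Radial interpolation inequality, for functions whose boundary term `[f ∂_r f]` is
nonpositive. -/
theorem nL2_pdr_sq_le {R₁ R₂ : ℝ} (hR : R₁ ≤ R₂) {f : ℝ → ℝ → ℝ}
    (hf : ContDiff ℝ (⊤ : ℕ∞) (fun p : ℝ × ℝ => f p.1 p.2))
    (hbd : ∀ θ, f R₂ θ * pdr f R₂ θ ≤ f R₁ θ * pdr f R₁ θ) :
    nL2 R₁ R₂ (pdr f) ^ 2 ≤ nL2 R₁ R₂ f * nL2 R₁ R₂ (pdrr f) := by
  have hfr := hf.pdr
  have hfrr : ContDiff ℝ (⊤ : ℕ∞) (fun p : ℝ × ℝ => pdrr f p.1 p.2) := hfr.pdr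
  refine nL2_sq_le_mul hR hf.continuous hfrr.continuous ?_
  have hsq : Continuous (fun p : ℝ × ℝ => pdr f p.1 p.2 ^ 2) := hfr.continuous.pow 2
  have hmul : Continuous (fun p : ℝ × ℝ => f p.1 p.2 * pdrr f p.1 p.2) :=
    hf.continuous.mul hfrr.continuous
  rw [intervalIntegral_swap_of_continuous (F := fun r θ => pdr f r θ ^ 2) hsq,
    intervalIntegral_swap_of_continuous (F := fun r θ => f r θ * pdrr f r θ) hmul,
    ← intervalIntegral.integral_neg]
  refine intervalIntegral.integral_mono_on two_pi_pos.le
    (Continuous.intervalIntegrable (Continuous.intervalIntegral_snd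
      (F := fun θ r => pdr f r θ ^ 2) (hsq.comp continuous_swap) _ _) _ _)
    (Continuous.intervalIntegrable (Continuous.intervalIntegral_snd
      (F := fun θ r => f r θ * pdrr f r θ) (hmul.comp continuous_swap) _ _).neg _ _)
    fun θ _ => ?_
  have parts := intervalIntegral.integral_mul_deriv_eq_deriv_mul (a := R₁) (b := R₂)
    (fun r _ => hf.hasDerivAt_pdr r θ) (fun r _ => hfr.hasDerivAt_pdr r θ)
    (Continuous.intervalIntegrable (hfr.continuous.comp (Continuous.prodMk_left θ)) _ _)
    (Continuous.intervalIntegrable (hfrr.continuous.comp (Continuous.prodMk_left θ)) _ _)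
  simp only [← sq] at parts
  have := hbd θ
  change _ ≤ -∫ r in R₁..R₂, f r θ * pdr (pdr f) r θ
  linarith

/-- Angular interpolation inequality for periodic functions. -/
theorem nL2_pdt_sq_le {R₁ R₂ : ℝ} (hR : R₁ ≤ R₂) {f : ℝ → ℝ → ℝ}
    (hf : ContDiff ℝ (⊤ : ℕ∞) (fun p : ℝ × ℝ => f p.1 p.2))
    (hper : ∀ r ∈ Icc R₁ R₂, ∀ θ : ℝ, f r (θ + 2 * π) = f r θ) :
    nL2 R₁ R₂ (pdt f) ^ 2 ≤ nL2 R₁ R₂ f * nL2 R₁ R₂ (pdtt f) := by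
  have hft := hf.pdt
  have hftt : ContDiff ℝ (⊤ : ℕ∞) (fun p : ℝ × ℝ => pdtt f p.1 p.2) := hft.pdt
  refine nL2_sq_le_mul hR hf.continuous hftt.continuous ?_
  rw [← intervalIntegral.integral_neg]
  refine (intervalIntegral.integral_congr fun r hr => ?_).le
  rw [uIcc_of_le hR] at hr
  have parts := intervalIntegral.integral_mul_deriv_eq_deriv_mul (a := 0) (b := 2 * π)
    (fun θ _ => hf.hasDerivAt_pdt r θ) (fun θ _ => hft.hasDerivAt_pdt r θ)
    (Continuous.intervalIntegrable (hft.continuous.comp (Continuous.prodMk_right r)) _ _)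
    (Continuous.intervalIntegrable (hftt.continuous.comp (Continuous.prodMk_right r)) _ _)
  have hf0 : f r (2 * π) = f r 0 := by simpa using hper r hr 0
  have hft0 : pdt f r (2 * π) = pdt f r 0 := by
    have h := deriv_comp_add_const (f r) (2 * π) 0
    rw [funext (hper r hr), zero_add] at h
    exact h.symm
  simp only [← sq, hf0, hft0] at parts
  change _ = -∫ θ in (0:ℝ)..(2 * π), f r θ * pdt (pdt f) r θ
  linarith

theorem statement2 (R₁ R₂ μ α : ℝ) (hR₁ : 0 < R₁) (hR₁₂ : R₁ < R₂) (hμ : 0 < μ)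
    (hα : 0 ≤ 1 - α * R₁ / μ) (vr vθ : ℝ → ℝ → ℝ)
    (hV : NavierAdmissible R₁ R₂ μ α vr vθ) :
    nL2 R₁ R₂ (pdr vr) ^ 2 ≤ nL2 R₁ R₂ vr * nL2 R₁ R₂ (pdrr vr) ∧
    nL2 R₁ R₂ (pdt vr) ^ 2 ≤ nL2 R₁ R₂ vr * nL2 R₁ R₂ (pdtt vr) ∧
    nL2 R₁ R₂ (pdr vθ) ^ 2 ≤ nL2 R₁ R₂ vθ * nL2 R₁ R₂ (pdrr vθ) ∧
    nL2 R₁ R₂ (pdt vθ) ^ 2 ≤ nL2 R₁ R₂ vθ * nL2 R₁ R₂ (pdtt vθ) := by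
  obtain ⟨⟨hvr, hvθ, hvr_per, hvθ_per, -, hvr₁, hvr₂, hvθ₂⟩, hslip⟩ := hV
  refine ⟨nL2_pdr_sq_le hR₁₂.le hvr fun θ => by simp [hvr₁, hvr₂],
    nL2_pdt_sq_le hR₁₂.le hvr hvr_per,
    nL2_pdr_sq_le hR₁₂.le hvθ fun θ => ?_,
    nL2_pdt_sq_le hR₁₂.le hvθ hvθ_per⟩
  have hcoef : 0 ≤ 1 / R₁ - α / μ := by
    have h : 1 / R₁ - α / μ = (1 - α * R₁ / μ) / R₁ := by field_simp
    rw [h]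
    exact div_nonneg hα hR₁.le
  rw [hvθ₂, hslip, zero_mul]
  nlinarith [mul_nonneg hcoef (sq_nonneg (vθ R₁ θ))]

end
end

section
/- Assume 1 − αR₁/μ ≥ 0. There exists a constant C > 0 depending only on R₁, R₂ such that for every Navier-admissible pair V = (v_r, v_θ) one has ‖∇̃V‖_{L⁴(Ω̃)}² ≤ C ‖∇̃V‖_{L²(Ω̃)} ‖∇̃²V‖_{L²(Ω̃)}, where ‖∇̃V‖_{L⁴(Ω̃)} = (∫∫ (|∂_r v_r|² + |∂_θ v_r|² + |∂_r v_θ|² + |∂_θ v_θ|²)² dθ dr)^{1/4}. -/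
open Real MeasureTheory Set

noncomputable section

/-- Smoothness of a function of two real variables. -/
def Smooth₂ (f : ℝ → ℝ → ℝ) : Prop :=
  ContDiff ℝ (⊤ : ℕ∞) (fun p : ℝ × ℝ => f p.1 p.2)

namespace Smooth₂

variable {f : ℝ → ℝ → ℝ}

lemma hasDerivAt_fst (hf : Smooth₂ f) (r θ : ℝ) :
    HasDerivAt (fun x => f x θ) (fderiv ℝ (fun p : ℝ × ℝ => f p.1 p.2) (r, θ) (1, 0)) r := by
  have h1 : HasFDerivAt (fun p : ℝ × ℝ => f p.1 p.2) _ (r, θ) :=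
    (ContDiff.differentiable hf (by simp) (r, θ)).hasFDerivAt
  have h2 : HasDerivAt (fun x : ℝ => (x, θ)) ((1 : ℝ), (0 : ℝ)) r :=
    (hasDerivAt_id r).prodMk (hasDerivAt_const r θ)
  exact h1.comp_hasDerivAt r h2

lemma hasDerivAt_snd (hf : Smooth₂ f) (r θ : ℝ) :
    HasDerivAt (fun y => f r y) (fderiv ℝ (fun p : ℝ × ℝ => f p.1 p.2) (r, θ) (0, 1)) θ := by
  have h1 : HasFDerivAt (fun p : ℝ × ℝ => f p.1 p.2) _ (r, θ) :=
    (ContDiff.differentiable hf (by simp) (r, θ)).hasFDerivAt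
  have h2 : HasDerivAt (fun y : ℝ => (r, y)) ((0 : ℝ), (1 : ℝ)) θ :=
    (hasDerivAt_const θ r).prodMk (hasDerivAt_id θ)
  exact h1.comp_hasDerivAt θ h2

lemma pdr_eq (hf : Smooth₂ f) (r θ : ℝ) :
    pdr f r θ = fderiv ℝ (fun p : ℝ × ℝ => f p.1 p.2) (r, θ) (1, 0) :=
  (hf.hasDerivAt_fst r θ).deriv

lemma pdt_eq (hf : Smooth₂ f) (r θ : ℝ) :
    pdt f r θ = fderiv ℝ (fun p : ℝ × ℝ => f p.1 p.2) (r, θ) (0, 1) :=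
  (hf.hasDerivAt_snd r θ).deriv

lemma hasDerivAt_pdr (hf : Smooth₂ f) (r θ : ℝ) :
    HasDerivAt (fun x => f x θ) (pdr f r θ) r := by
  rw [hf.pdr_eq]; exact hf.hasDerivAt_fst r θ

lemma hasDerivAt_pdt (hf : Smooth₂ f) (r θ : ℝ) :
    HasDerivAt (fun y => f r y) (pdt f r θ) θ := by
  rw [hf.pdt_eq]; exact hf.hasDerivAt_snd r θ

lemma contDiff_fderiv (hf : Smooth₂ f) :
    ContDiff ℝ (⊤ : ℕ∞) (fderiv ℝ (fun p : ℝ × ℝ => f p.1 p.2)) :=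
  ContDiff.fderiv_right hf (by simp)

lemma pdr (hf : Smooth₂ f) : Smooth₂ (pdr f) := by
  have h : (fun p : ℝ × ℝ => _root_.pdr f p.1 p.2) =
      fun p => fderiv ℝ (fun p : ℝ × ℝ => f p.1 p.2) p (1, 0) :=
    funext fun p => hf.pdr_eq p.1 p.2
  unfold Smooth₂
  rw [h]
  exact hf.contDiff_fderiv.clm_apply contDiff_const

lemma pdt (hf : Smooth₂ f) : Smooth₂ (pdt f) := by
  have h : (fun p : ℝ × ℝ => _root_.pdt f p.1 p.2) =
      fun p => fderiv ℝ (fun p : ℝ × ℝ => f p.1 p.2) p (0, 1) :=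
    funext fun p => hf.pdt_eq p.1 p.2
  unfold Smooth₂
  rw [h]
  exact hf.contDiff_fderiv.clm_apply contDiff_const

lemma continuous (hf : Smooth₂ f) : Continuous (fun p : ℝ × ℝ => f p.1 p.2) :=
  ContDiff.continuous hf

/-- The mixed second-order partial derivatives commute. -/
lemma pdt_pdr (hf : Smooth₂ f) (r θ : ℝ) :
    _root_.pdt (_root_.pdr f) r θ = _root_.pdr (_root_.pdt f) r θ := by
  have hsymm : IsSymmSndFDerivAt ℝ (fun p : ℝ × ℝ => f p.1 p.2) (r, θ) :=
    (ContDiff.contDiffAt hf).isSymmSndFDerivAt (by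
      simpa using WithTop.coe_le_coe.2 (le_top : (2 : ℕ∞) ≤ ⊤))
  have hd : DifferentiableAt ℝ (fderiv ℝ (fun p : ℝ × ℝ => f p.1 p.2)) (r, θ) :=
    hf.contDiff_fderiv.differentiable (by simp) _
  rw [hf.pdr.pdt_eq, hf.pdt.pdr_eq]
  have h1 : (fun p : ℝ × ℝ => _root_.pdr f p.1 p.2) =
      fun p => fderiv ℝ (fun p : ℝ × ℝ => f p.1 p.2) p (1, 0) :=
    funext fun p => hf.pdr_eq p.1 p.2
  have h2 : (fun p : ℝ × ℝ => _root_.pdt f p.1 p.2) =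
      fun p => fderiv ℝ (fun p : ℝ × ℝ => f p.1 p.2) p (0, 1) :=
    funext fun p => hf.pdt_eq p.1 p.2
  rw [h1, h2, fderiv_clm_apply hd (differentiableAt_const _),
    fderiv_clm_apply hd (differentiableAt_const _)]
  simpa using hsymm (0, 1) (1, 0)

end Smooth₂

/-- The iterated integral over the rectangle `[a,b] × [c,d]`. -/
def rectIntegral (a b c d : ℝ) (F : ℝ → ℝ → ℝ) : ℝ :=
  ∫ r in a..b, ∫ θ in c..d, F r θ

section rectIntegral

variable {a b c d : ℝ} {F G : ℝ → ℝ → ℝ}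

lemma continuous_integral_snd (hF : Continuous fun p : ℝ × ℝ => F p.1 p.2) :
    Continuous fun r => ∫ θ in c..d, F r θ :=
  intervalIntegral.continuous_parametric_intervalIntegral_of_continuous' (f := F) hF c d

lemma continuous_integral_fst (hF : Continuous fun p : ℝ × ℝ => F p.1 p.2) :
    Continuous fun θ => ∫ r in a..b, F r θ :=
  intervalIntegral.continuous_parametric_intervalIntegral_of_continuous'
    (f := fun θ r => F r θ) (hF.comp continuous_swap) a b

lemma continuous_section_snd (hF : Continuous fun p : ℝ × ℝ => F p.1 p.2) (r : ℝ) :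
    Continuous fun θ => F r θ :=
  hF.comp (Continuous.prodMk_right r)

lemma continuous_section_fst (hF : Continuous fun p : ℝ × ℝ => F p.1 p.2) (θ : ℝ) :
    Continuous fun r => F r θ :=
  hF.comp (Continuous.prodMk_left θ)

lemma rectIntegral_add (hF : Continuous fun p : ℝ × ℝ => F p.1 p.2)
    (hG : Continuous fun p : ℝ × ℝ => G p.1 p.2) :
    rectIntegral a b c d (fun r θ => F r θ + G r θ) =
      rectIntegral a b c d F + rectIntegral a b c d G := by
  unfold rectIntegral
  rw [← intervalIntegral.integral_add
    ((continuous_integral_snd hF).intervalIntegrable _ _)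
    ((continuous_integral_snd hG).intervalIntegrable _ _)]
  congr 1 with r
  exact intervalIntegral.integral_add
    ((continuous_section_snd hF r).intervalIntegrable _ _)
    ((continuous_section_snd hG r).intervalIntegrable _ _)

lemma rectIntegral_const_mul (k : ℝ) :
    rectIntegral a b c d (fun r θ => k * F r θ) = k * rectIntegral a b c d F := by
  simp only [rectIntegral, intervalIntegral.integral_const_mul]

lemma rectIntegral_mono (hab : a ≤ b) (hcd : c ≤ d)
    (hF : Continuous fun p : ℝ × ℝ => F p.1 p.2) (hG : Continuous fun p : ℝ × ℝ => G p.1 p.2)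
    (h : ∀ r ∈ Icc a b, ∀ θ ∈ Icc c d, F r θ ≤ G r θ) :
    rectIntegral a b c d F ≤ rectIntegral a b c d G :=
  intervalIntegral.integral_mono_on hab
    ((continuous_integral_snd hF).intervalIntegrable _ _)
    ((continuous_integral_snd hG).intervalIntegrable _ _) fun r hr =>
      intervalIntegral.integral_mono_on hcd
        ((continuous_section_snd hF r).intervalIntegrable _ _)
        ((continuous_section_snd hG r).intervalIntegrable _ _) (h r hr)

lemma rectIntegral_nonneg (hab : a ≤ b) (hcd : c ≤ d) (h : ∀ r θ, 0 ≤ F r θ) :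
    0 ≤ rectIntegral a b c d F :=
  intervalIntegral.integral_nonneg hab fun r _ =>
    intervalIntegral.integral_nonneg hcd fun θ _ => h r θ

lemma rectIntegral_swap (hF : Continuous fun p : ℝ × ℝ => F p.1 p.2) :
    rectIntegral a b c d F = ∫ θ in c..d, ∫ r in a..b, F r θ := by
  refine intervalIntegral_intervalIntegral_swap ?_
  have h : IntegrableOn (fun p : ℝ × ℝ => F p.1 p.2) (uIcc a b ×ˢ uIcc c d) :=
    hF.continuousOn.integrableOn_compact (isCompact_uIcc.prod isCompact_uIcc)
  exact h.mono_set (prod_mono uIoc_subset_uIcc uIoc_subset_uIcc)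

lemma rectIntegral_fst_mul_snd (u v : ℝ → ℝ) :
    rectIntegral a b c d (fun r θ => u θ * v r) = (∫ θ in c..d, u θ) * ∫ r in a..b, v r := by
  simp only [rectIntegral, intervalIntegral.integral_mul_const,
    intervalIntegral.integral_const_mul]

/-- The Cauchy–Schwarz inequality on a rectangle. -/
lemma sq_rectIntegral_abs_mul_le (hab : a ≤ b) (hcd : c ≤ d)
    (hF : Continuous fun p : ℝ × ℝ => F p.1 p.2) (hG : Continuous fun p : ℝ × ℝ => G p.1 p.2) :
    rectIntegral a b c d (fun r θ => |F r θ * G r θ|) ^ 2 ≤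
      rectIntegral a b c d (fun r θ => F r θ ^ 2) *
        rectIntegral a b c d (fun r θ => G r θ ^ 2) := by
  have key : ∀ t : ℝ, 0 ≤ rectIntegral a b c d (fun r θ => F r θ ^ 2) * (t * t) +
      (-2 * rectIntegral a b c d (fun r θ => |F r θ * G r θ|)) * t +
        rectIntegral a b c d (fun r θ => G r θ ^ 2) := by
    intro t
    have h0 : 0 ≤ rectIntegral a b c d (fun r θ => (t * |F r θ| - |G r θ|) ^ 2) :=
      rectIntegral_nonneg hab hcd fun r θ => sq_nonneg _
    have h1 : (fun r θ => (t * |F r θ| - |G r θ|) ^ 2) = fun r θ =>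
        (t * t) * F r θ ^ 2 + ((-2 * t) * |F r θ * G r θ| + G r θ ^ 2) := by
      funext r θ
      rw [abs_mul, ← sq_abs (F r θ), ← sq_abs (G r θ)]
      ring
    rw [h1, rectIntegral_add (by fun_prop) (by fun_prop),
      rectIntegral_add (by fun_prop) (by fun_prop), rectIntegral_const_mul,
      rectIntegral_const_mul] at h0
    linarith
  have := discrim_le_zero key
  unfold discrim at this
  nlinarith

end rectIntegral

/-- A one-dimensional Agmon-type inequality between two points of an interval. -/
lemma sq_le_sq_add_integral {a b : ℝ} (hab : a ≤ b) {g g' : ℝ → ℝ}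
    (hg : ∀ x, HasDerivAt g (g' x) x) (hg' : Continuous g') {x y : ℝ}
    (hx : x ∈ Icc a b) (hy : y ∈ Icc a b) :
    g x ^ 2 ≤ g y ^ 2 + 2 * ∫ t in a..b, |g t * g' t| := by
  have hgc : Continuous g := continuous_iff_continuousAt.2 fun t => (hg t).continuousAt
  have hcont : Continuous fun t => 2 * (g t * g' t) := by fun_prop
  have hftc : ∫ t in y..x, 2 * (g t * g' t) = g x ^ 2 - g y ^ 2 := by
    refine intervalIntegral.integral_eq_sub_of_hasDerivAt (f := fun t => g t ^ 2)
      (fun t _ => ?_) (hcont.intervalIntegrable _ _)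
    have h := (hg t).fun_pow 2
    norm_num at h
    rwa [mul_assoc] at h
  have h1 : g x ^ 2 - g y ^ 2 ≤ |∫ t in y..x, (|2 * (g t * g' t)|)| := by
    rw [← hftc]
    refine (le_abs_self _).trans ?_
    simpa only [Real.norm_eq_abs] using
      intervalIntegral.norm_integral_le_abs_integral_norm (f := fun t => 2 * (g t * g' t))
        (a := y) (b := x) (μ := volume)
  have h2 : |∫ t in y..x, (|2 * (g t * g' t)|)| ≤ |∫ t in a..b, (|2 * (g t * g' t)|)| := by
    refine intervalIntegral.abs_integral_mono_interval ?_ ?_ (hcont.abs.intervalIntegrable _ _)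
    · rw [uIoc_of_le hab]
      exact Ioc_subset_Ioc (le_min hy.1 hx.1) (max_le hy.2 hx.2)
    · exact Filter.Eventually.of_forall fun t => abs_nonneg _
  have h3 : |∫ t in a..b, (|2 * (g t * g' t)|)| = 2 * ∫ t in a..b, |g t * g' t| := by
    rw [abs_of_nonneg (intervalIntegral.integral_nonneg hab fun t _ => abs_nonneg _),
      ← intervalIntegral.integral_const_mul]
    simp only [abs_mul, abs_two]
  linarith

lemma mul_sq_le_integral {c d : ℝ} (hcd : c ≤ d) {g g' : ℝ → ℝ}
    (hg : ∀ x, HasDerivAt g (g' x) x) (hg' : Continuous g') {x : ℝ} (hx : x ∈ Icc c d) :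
    (d - c) * g x ^ 2 ≤
      (∫ t in c..d, g t ^ 2) + (d - c) * (2 * ∫ t in c..d, |g t * g' t|) := by
  have hgc : Continuous g := continuous_iff_continuousAt.2 fun t => (hg t).continuousAt
  have hg2 : Continuous fun t => g t ^ 2 := hgc.pow 2
  have h := intervalIntegral.integral_mono_on (μ := volume) hcd
    (continuous_const (y := g x ^ 2).intervalIntegrable c d)
    ((hg2.add (continuous_const (y := 2 * ∫ t in c..d, |g t * g' t|))).intervalIntegrable
      c d) fun y hy =>
      sq_le_sq_add_integral hcd hg hg' hx hy
  simp only [Pi.add_apply] at h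
  rw [intervalIntegral.integral_add (hg2.intervalIntegrable _ _)
    (continuous_const.intervalIntegrable _ _)] at h
  simpa only [intervalIntegral.integral_const, smul_eq_mul] using h

/-- A Ladyzhenskaya inequality on a rectangle for functions having a zero on every
horizontal segment. -/
lemma ladyzhenskaya_rect {a b c d : ℝ} (hab : a ≤ b) (hcd : c < d) {f : ℝ → ℝ → ℝ}
    (hf : Smooth₂ f) (hz : ∀ θ, ∃ r₀ ∈ Icc a b, f r₀ θ = 0) :
    rectIntegral a b c d (fun r θ => f r θ ^ 4) ≤
      4 * ((b - a) / (d - c) + 1) * rectIntegral a b c d (fun r θ => f r θ ^ 2) *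
        (rectIntegral a b c d (fun r θ => pdr f r θ ^ 2) +
          rectIntegral a b c d (fun r θ => pdt f r θ ^ 2)) := by
  have cf := hf.continuous
  have cr := hf.pdr.continuous
  have ct := hf.pdt.continuous
  have cfr : Continuous fun p : ℝ × ℝ => |f p.1 p.2 * pdr f p.1 p.2| := (cf.mul cr).abs
  have cft : Continuous fun p : ℝ × ℝ => |f p.1 p.2 * pdt f p.1 p.2| := (cf.mul ct).abs
  have cf2 : Continuous fun p : ℝ × ℝ => f p.1 p.2 ^ 2 := cf.pow 2
  have hM : 0 < d - c := sub_pos.2 hcd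
  set A : ℝ → ℝ := fun θ => 2 * ∫ r in a..b, |f r θ * pdr f r θ| with hA
  set B : ℝ → ℝ := fun r =>
    (d - c)⁻¹ * (∫ θ in c..d, f r θ ^ 2) + 2 * ∫ θ in c..d, |f r θ * pdt f r θ| with hB
  have cA : Continuous A := continuous_const.mul
    (continuous_integral_fst (F := fun r θ => |f r θ * pdr f r θ|) cfr)
  have cB1 : Continuous fun r => (d - c)⁻¹ * (∫ θ in c..d, f r θ ^ 2) := continuous_const.mul
    (continuous_integral_snd (F := fun r θ => f r θ ^ 2) cf2)
  have cB2 : Continuous fun r => 2 * ∫ θ in c..d, |f r θ * pdt f r θ| := continuous_const.mul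
    (continuous_integral_snd (F := fun r θ => |f r θ * pdt f r θ|) cft)
  have cB : Continuous B := cB1.add cB2
  have hfA : ∀ r ∈ Icc a b, ∀ θ, f r θ ^ 2 ≤ A θ := by
    intro r hr θ
    obtain ⟨r₀, hr₀, h0⟩ := hz θ
    have := sq_le_sq_add_integral hab (fun x => hf.hasDerivAt_pdr x θ)
      (continuous_section_fst cr θ) hr hr₀
    rwa [h0, zero_pow two_ne_zero, zero_add] at this
  have hfB : ∀ r, ∀ θ ∈ Icc c d, f r θ ^ 2 ≤ B r := by
    intro r θ hθ
    have := mul_sq_le_integral hcd.le (fun x => hf.hasDerivAt_pdt r x)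
      (continuous_section_snd ct r) hθ
    refine le_of_mul_le_mul_left (this.trans_eq ?_) hM
    rw [hB, mul_add, mul_inv_cancel_left₀ hM.ne']
  set X := rectIntegral a b c d (fun r θ => |f r θ * pdr f r θ|) with hX
  set Y := rectIntegral a b c d (fun r θ => |f r θ * pdt f r θ|) with hY
  set S := rectIntegral a b c d (fun r θ => f r θ ^ 2) with hS
  have hX0 : 0 ≤ X := rectIntegral_nonneg hab hcd.le fun _ _ => abs_nonneg _
  have hIA : ∫ θ in c..d, A θ = 2 * X := by
    rw [hX, rectIntegral_swap cfr, hA, intervalIntegral.integral_const_mul]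
  have hIB : ∫ r in a..b, B r = (d - c)⁻¹ * S + 2 * Y := by
    rw [hB, intervalIntegral.integral_add (cB1.intervalIntegrable _ _)
      (cB2.intervalIntegrable _ _), intervalIntegral.integral_const_mul,
      intervalIntegral.integral_const_mul]
    rfl
  have h4 : rectIntegral a b c d (fun r θ => f r θ ^ 4) ≤ 2 * X * ((d - c)⁻¹ * S + 2 * Y) := by
    rw [← hIA, ← hIB, ← rectIntegral_fst_mul_snd]
    refine rectIntegral_mono hab hcd.le (cf.pow 4)
      ((cA.comp continuous_snd).mul (cB.comp continuous_fst)) fun r hr θ hθ => ?_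
    calc f r θ ^ 4 = f r θ ^ 2 * f r θ ^ 2 := by ring
      _ ≤ A θ * B r := mul_le_mul (hfA r hr θ) (hfB r θ hθ) (sq_nonneg _)
        ((sq_nonneg _).trans (hfA r hr θ))
  have hSX : S ≤ 2 * X * (b - a) := by
    have h := rectIntegral_mono (G := fun r θ => A θ * 1) hab hcd.le cf2
      ((cA.comp continuous_snd).mul continuous_const) fun r hr θ _ => by
        simpa using hfA r hr θ
    rw [rectIntegral_fst_mul_snd A (fun _ => 1), hIA] at h
    simpa using h
  have hXX : X ^ 2 ≤ S * rectIntegral a b c d (fun r θ => pdr f r θ ^ 2) :=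
    sq_rectIntegral_abs_mul_le hab hcd.le cf cr
  have hYY : Y ^ 2 ≤ S * rectIntegral a b c d (fun r θ => pdt f r θ ^ 2) :=
    sq_rectIntegral_abs_mul_le hab hcd.le cf ct
  have hL : 0 ≤ (b - a) / (d - c) := div_nonneg (sub_nonneg.2 hab) hM.le
  calc rectIntegral a b c d (fun r θ => f r θ ^ 4)
      ≤ 2 * X * ((d - c)⁻¹ * S + 2 * Y) := h4
    _ ≤ 2 * X * ((d - c)⁻¹ * (2 * X * (b - a)) + 2 * Y) := by gcongr
    _ = 4 * ((b - a) / (d - c) * X ^ 2 + X * Y) := by ring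
    _ ≤ 4 * ((b - a) / (d - c) + 1) * (X ^ 2 + Y ^ 2) := by
        nlinarith [mul_nonneg hL (sq_nonneg Y), sq_nonneg (X - Y), sq_nonneg X, sq_nonneg Y]
    _ ≤ 4 * ((b - a) / (d - c) + 1) *
        (S * rectIntegral a b c d (fun r θ => pdr f r θ ^ 2) +
          S * rectIntegral a b c d (fun r θ => pdt f r θ ^ 2)) := by gcongr
    _ = _ := by ring

/-- If `g` vanishes at `b` and `g' a` is a nonnegative multiple of `g a`, then `g'` has a zero. -/
lemma exists_deriv_zero_of_navier {a b k : ℝ} (hab : a < b) (hk : 0 ≤ k) {g g' : ℝ → ℝ}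
    (hg : ∀ x, HasDerivAt g (g' x) x) (hg' : Continuous g') (hb : g b = 0)
    (ha : g' a = k * g a) : ∃ x ∈ Icc a b, g' x = 0 := by
  have hgc : Continuous g := continuous_iff_continuousAt.2 fun t => (hg t).continuousAt
  obtain ⟨ξ, hξ, hslope⟩ := exists_hasDerivAt_eq_slope g g' hab hgc.continuousOn fun x _ => hg x
  have hsl : g' ξ = -(g a) / (b - a) := by rw [hslope, hb, zero_sub]
  have hba : 0 < b - a := sub_pos.2 hab
  have h0 : (0 : ℝ) ∈ uIcc (g' a) (g' ξ) := by
    rw [mem_uIcc, ha, hsl]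
    rcases le_total 0 (g a) with h | h
    · exact Or.inr ⟨div_nonpos_of_nonpos_of_nonneg (neg_nonpos.2 h) hba.le, mul_nonneg hk h⟩
    · exact Or.inl ⟨mul_nonpos_of_nonneg_of_nonpos hk h, div_nonneg (neg_nonneg.2 h) hba.le⟩
  obtain ⟨x, hx, hx0⟩ := intermediate_value_uIcc hg'.continuousOn h0
  rw [uIcc_of_le hξ.1.le] at hx
  exact ⟨x, ⟨hx.1, hx.2.trans hξ.2.le⟩, hx0⟩

theorem statement3 (R₁ R₂ : ℝ) (hR₁ : 0 < R₁) (hR₁₂ : R₁ < R₂) :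
    ∃ C : ℝ, 0 < C ∧
      ∀ μ α : ℝ, 0 < μ → 0 ≤ 1 - α * R₁ / μ →
        ∀ vr vθ : ℝ → ℝ → ℝ, NavierAdmissible R₁ R₂ μ α vr vθ →
          ((∫ r in R₁..R₂, ∫ θ in (0:ℝ)..(2 * π),
              ((pdr vr r θ) ^ 2 + (pdt vr r θ) ^ 2 + (pdr vθ r θ) ^ 2 + (pdt vθ r θ) ^ 2) ^ 2)
              ^ ((1:ℝ) / 4)) ^ 2 ≤
            C * Real.sqrt (gradSq R₁ R₂ vr vθ) *
              Real.sqrt (∫ r in R₁..R₂, ∫ θ in (0:ℝ)..(2 * π),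
                ((pdrr vr r θ) ^ 2 + (pdrt vr r θ) ^ 2 + (pdtt vr r θ) ^ 2 +
                  (pdrr vθ r θ) ^ 2 + (pdrt vθ r θ) ^ 2 + (pdtt vθ r θ) ^ 2)) := by
  have hπ : (0 : ℝ) < 2 * π := by positivity
  set K : ℝ := 4 * ((R₂ - R₁) / (2 * π - 0) + 1) with hK
  have hK0 : 0 < K := by
    have : 0 ≤ (R₂ - R₁) / (2 * π - 0) := div_nonneg (by linarith) (by linarith)
    positivity
  refine ⟨√(8 * K), by positivity, fun μ α _ hα vr vθ h => ?_⟩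
  obtain ⟨⟨hr, ht, -, -, -, hr1, hr2, ht2⟩, hN⟩ := h
  replace hr : Smooth₂ vr := hr
  replace ht : Smooth₂ vθ := ht
  have hk : 0 ≤ 1 / R₁ - α / μ := by
    have : 1 / R₁ - α / μ = (1 - α * R₁ / μ) / R₁ := by field_simp
    rw [this]
    exact div_nonneg hα hR₁.le
  have hle := hR₁₂.le
  have z1 : ∀ θ, ∃ r₀ ∈ Icc R₁ R₂, pdr vr r₀ θ = 0 := fun θ => by
    obtain ⟨x, hx, h0⟩ := exists_hasDerivAt_eq_zero hR₁₂
      (fun x _ => (hr.hasDerivAt_pdr x θ).continuousAt.continuousWithinAt)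
      ((hr1 θ).trans (hr2 θ).symm) fun x _ => hr.hasDerivAt_pdr x θ
    exact ⟨x, Ioo_subset_Icc_self hx, h0⟩
  have z2 : ∀ θ, ∃ r₀ ∈ Icc R₁ R₂, pdt vr r₀ θ = 0 := fun θ =>
    ⟨R₁, left_mem_Icc.2 hle, by simp [pdt, hr1]⟩
  have z3 : ∀ θ, ∃ r₀ ∈ Icc R₁ R₂, pdr vθ r₀ θ = 0 := fun θ =>
    exists_deriv_zero_of_navier hR₁₂ hk (fun x => ht.hasDerivAt_pdr x θ)
      (continuous_section_fst ht.pdr.continuous θ) (ht2 θ) (hN θ)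
  have z4 : ∀ θ, ∃ r₀ ∈ Icc R₁ R₂, pdt vθ r₀ θ = 0 := fun θ =>
    ⟨R₂, right_mem_Icc.2 hle, by simp [pdt, ht2]⟩
  have l1 := ladyzhenskaya_rect hle hπ hr.pdr z1
  have l2 := ladyzhenskaya_rect hle hπ hr.pdt z2
  have l3 := ladyzhenskaya_rect hle hπ ht.pdr z3
  have l4 := ladyzhenskaya_rect hle hπ ht.pdt z4
  simp only [hr.pdt_pdr, ht.pdt_pdr, ← hK] at l1 l2 l3 l4
  have c1 := hr.pdr.continuous
  have c2 := hr.pdt.continuous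
  have c3 := ht.pdr.continuous
  have c4 := ht.pdt.continuous
  have d1 := hr.pdr.pdr.continuous
  have d2 := hr.pdt.pdr.continuous
  have d3 := hr.pdt.pdt.continuous
  have d4 := ht.pdr.pdr.continuous
  have d5 := ht.pdt.pdr.continuous
  have d6 := ht.pdt.pdt.continuous
  set I := rectIntegral R₁ R₂ 0 (2 * π) with hI
  have pos : ∀ f : ℝ → ℝ → ℝ, 0 ≤ I fun r θ => f r θ ^ 2 := fun f =>
    rectIntegral_nonneg hle hπ.le fun _ _ => sq_nonneg _
  have hG : gradSq R₁ R₂ vr vθ = I (fun r θ => pdr vr r θ ^ 2) + I (fun r θ => pdt vr r θ ^ 2) +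
      I (fun r θ => pdr vθ r θ ^ 2) + I (fun r θ => pdt vθ r θ ^ 2) := by
    rw [hI, ← rectIntegral_add (by fun_prop) (by fun_prop),
      ← rectIntegral_add (by fun_prop) (by fun_prop),
      ← rectIntegral_add (by fun_prop) (by fun_prop)]
    rfl
  have hH : (∫ r in R₁..R₂, ∫ θ in (0:ℝ)..(2 * π),
      ((pdrr vr r θ) ^ 2 + (pdrt vr r θ) ^ 2 + (pdtt vr r θ) ^ 2 +
        (pdrr vθ r θ) ^ 2 + (pdrt vθ r θ) ^ 2 + (pdtt vθ r θ) ^ 2)) =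
      I (fun r θ => pdr (pdr vr) r θ ^ 2) + I (fun r θ => pdr (pdt vr) r θ ^ 2) +
      I (fun r θ => pdt (pdt vr) r θ ^ 2) + I (fun r θ => pdr (pdr vθ) r θ ^ 2) +
      I (fun r θ => pdr (pdt vθ) r θ ^ 2) + I (fun r θ => pdt (pdt vθ) r θ ^ 2) := by
    rw [hI, ← rectIntegral_add (by fun_prop) (by fun_prop),
      ← rectIntegral_add (by fun_prop) (by fun_prop),
      ← rectIntegral_add (by fun_prop) (by fun_prop),
      ← rectIntegral_add (by fun_prop) (by fun_prop),
      ← rectIntegral_add (by fun_prop) (by fun_prop)]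
    rfl
  have hQ : (∫ r in R₁..R₂, ∫ θ in (0:ℝ)..(2 * π),
      ((pdr vr r θ) ^ 2 + (pdt vr r θ) ^ 2 + (pdr vθ r θ) ^ 2 + (pdt vθ r θ) ^ 2) ^ 2) ≤
      4 * (I (fun r θ => pdr vr r θ ^ 4) + I (fun r θ => pdt vr r θ ^ 4) +
      I (fun r θ => pdr vθ r θ ^ 4) + I (fun r θ => pdt vθ r θ ^ 4)) := by
    rw [hI, ← rectIntegral_add (by fun_prop) (by fun_prop),
      ← rectIntegral_add (by fun_prop) (by fun_prop),
      ← rectIntegral_add (by fun_prop) (by fun_prop), ← rectIntegral_const_mul]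
    refine rectIntegral_mono hle hπ.le (by fun_prop) (by fun_prop) fun r _ θ _ => ?_
    have sq4 : ∀ x y z w : ℝ, (x ^ 2 + y ^ 2 + z ^ 2 + w ^ 2) ^ 2 ≤
        4 * (x ^ 4 + y ^ 4 + z ^ 4 + w ^ 4) := fun x y z w => by
      nlinarith [sq_nonneg (x ^ 2 - y ^ 2), sq_nonneg (x ^ 2 - z ^ 2), sq_nonneg (x ^ 2 - w ^ 2),
        sq_nonneg (y ^ 2 - z ^ 2), sq_nonneg (y ^ 2 - w ^ 2), sq_nonneg (z ^ 2 - w ^ 2)]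
    exact sq4 _ _ _ _
  have p1 := pos (pdr vr)
  have p2 := pos (pdt vr)
  have p3 := pos (pdr vθ)
  have p4 := pos (pdt vθ)
  have q1 := pos (pdr (pdr vr))
  have q2 := pos (pdr (pdt vr))
  have q3 := pos (pdt (pdt vr))
  have q4 := pos (pdr (pdr vθ))
  have q5 := pos (pdr (pdt vθ))
  have q6 := pos (pdt (pdt vθ))
  rw [hH]
  set Q := ∫ r in R₁..R₂, ∫ θ in (0:ℝ)..(2 * π),
    ((pdr vr r θ) ^ 2 + (pdt vr r θ) ^ 2 + (pdr vθ r θ) ^ 2 + (pdt vθ r θ) ^ 2) ^ 2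
  set G := gradSq R₁ R₂ vr vθ
  have hG0 : 0 ≤ G := by rw [hG]; positivity
  have hQ0 : 0 ≤ Q := rectIntegral_nonneg hle hπ.le fun _ _ => sq_nonneg _
  have scale : ∀ {x s t : ℝ}, x ≤ K * s * t → s ≤ G → 0 ≤ t → x ≤ K * G * t :=
    fun hx hs ht => hx.trans (by gcongr)
  replace l1 := scale l1 (by linarith) (by linarith)
  replace l2 := scale l2 (by linarith) (by linarith)
  replace l3 := scale l3 (by linarith) (by linarith)
  replace l4 := scale l4 (by linarith) (by linarith)
  have hKG : 0 ≤ K * G := mul_nonneg hK0.le hG0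
  rw [← Real.sqrt_mul (by positivity), ← Real.sqrt_mul (by positivity)]
  have hroot : (Q ^ ((1:ℝ) / 4)) ^ 2 = √Q := by
    rw [← Real.rpow_natCast, ← Real.rpow_mul hQ0, Real.sqrt_eq_rpow]
    norm_num
  rw [hroot]
  refine Real.sqrt_le_sqrt (hQ.trans ?_)
  nlinarith [mul_nonneg hKG q1, mul_nonneg hKG q2, mul_nonneg hKG q3, mul_nonneg hKG q4,
    mul_nonneg hKG q5, mul_nonneg hKG q6]

end
end

section
/- For all real numbers 0 < a ≤ b and 0 < c ≤ d there exists a constant M > 0, depending on a, b, c, d (and on R₁, R₂, μ, α, g, ρ̄), such that |Φ(s,ξ)| ≤ M for all (s,ξ) ∈ [a,b] × [c,d]. -/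
open Real MeasureTheory Set

noncomputable section

/-- The function `r ↦ r W(r)`. -/
def rW (W : ℝ → ℝ) : ℝ → ℝ := fun r => r * W r

/-- The functional `E₁(ξ,W) = ∫_I [ξ² r ρ̄ W² + r ρ̄ |D(rW)|²] dr`. -/
def E1fun (R₁ R₂ : ℝ) (ρ : ℝ → ℝ) (ξ : ℝ) (W : ℝ → ℝ) : ℝ :=
  ∫ r in R₁..R₂, (ξ ^ 2 * r * ρ r * (W r) ^ 2 + r * ρ r * (deriv (rW W) r) ^ 2)

/-- The functional `E₂(ξ,W)`. -/
def E2fun (R₁ R₂ μ α : ℝ) (ξ : ℝ) (W : ℝ → ℝ) : ℝ :=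
  (∫ r in R₁..R₂,
    (r * (2 * ξ ^ 2 + 1) * (deriv W r) ^ 2 + ((ξ ^ 2 - 1) ^ 2 / r) * (W r) ^ 2 +
      r * (deriv (deriv (rW W)) r) ^ 2)) +
  (1 - α / μ * R₁) * (deriv (rW W) R₁) ^ 2

/-- The functional `E₃(ξ,W) = −ξ² ∫_I g r W² Dρ̄ dr`. -/
def E3fun (R₁ R₂ g : ℝ) (ρ : ℝ → ℝ) (ξ : ℝ) (W : ℝ → ℝ) : ℝ :=
  -(ξ ^ 2) * ∫ r in R₁..R₂, g * r * (W r) ^ 2 * deriv ρ r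

/-- The functional `E(s,ξ,W) = μ s E₂(ξ,W) + E₃(ξ,W)`. -/
def Efun (R₁ R₂ μ α g : ℝ) (ρ : ℝ → ℝ) (s ξ : ℝ) (W : ℝ → ℝ) : ℝ :=
  μ * s * E2fun R₁ R₂ μ α ξ W + E3fun R₁ R₂ g ρ ξ W

/-- Admissible profile: `W ∈ C²`, `W(R₁) = W(R₂) = 0` and `DW(R₂) = 0`. -/
def AdmW (R₁ R₂ : ℝ) (W : ℝ → ℝ) : Prop :=
  ContDiff ℝ 2 W ∧ W R₁ = 0 ∧ W R₂ = 0 ∧ deriv W R₂ = 0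

/-- The set of values `E(s,ξ,W)/E₁(ξ,W)` over admissible, not identically zero, `W`. -/
def PhiSet (R₁ R₂ μ α g : ℝ) (ρ : ℝ → ℝ) (s ξ : ℝ) : Set ℝ :=
  {x : ℝ | ∃ W : ℝ → ℝ, AdmW R₁ R₂ W ∧ (∃ r ∈ Icc R₁ R₂, W r ≠ 0) ∧
    x = Efun R₁ R₂ μ α g ρ s ξ W / E1fun R₁ R₂ ρ ξ W}

/-- `Φ(s,ξ) = inf { E(s,ξ,W)/E₁(ξ,W) : W admissible, W ≢ 0 }`. -/
def Phi (R₁ R₂ μ α g : ℝ) (ρ : ℝ → ℝ) (s ξ : ℝ) : ℝ :=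
  sInf (PhiSet R₁ R₂ μ α g ρ s ξ)

/-- `λ_c(ξ) = sup { −E₃(ξ,W) : W admissible, μ E₂(ξ,W) = 1 }`. -/
def lamc (R₁ R₂ μ α g : ℝ) (ρ : ℝ → ℝ) (ξ : ℝ) : ℝ :=
  sSup {x : ℝ | ∃ W : ℝ → ℝ, AdmW R₁ R₂ W ∧ μ * E2fun R₁ R₂ μ α ξ W = 1 ∧
    x = -E3fun R₁ R₂ g ρ ξ W}

theorem contDiff_rW {W : ℝ → ℝ} (hW : ContDiff ℝ 2 W) : ContDiff ℝ 2 (rW W) :=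
  contDiff_id.mul hW

theorem continuous_deriv_deriv_rW {W : ℝ → ℝ} (hW : ContDiff ℝ 2 W) :
    Continuous (deriv (deriv (rW W))) := by
  have h : ContDiff ℝ (1 + 1) (rW W) := by
    rw [one_add_one_eq_two]; exact contDiff_rW hW
  exact (contDiff_succ_iff_deriv.1 h).2.2.continuous_deriv le_rfl

theorem E2fun_nonneg {R₁ R₂ μ α : ℝ} (hR₁ : 0 < R₁) (hR₁₂ : R₁ < R₂)
    (hα : 0 ≤ 1 - α * R₁ / μ) (ξ : ℝ) (W : ℝ → ℝ) : 0 ≤ E2fun R₁ R₂ μ α ξ W := by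
  refine add_nonneg (intervalIntegral.integral_nonneg hR₁₂.le fun r hr => ?_)
    (mul_nonneg ?_ (sq_nonneg _))
  · have : 0 < r := hR₁.trans_le hr.1
    positivity
  · rwa [div_mul_eq_mul_div]

theorem E1fun_nonneg {R₁ R₂ : ℝ} (hR₁ : 0 < R₁) (hR₁₂ : R₁ < R₂) {ρ : ℝ → ℝ}
    (hρpos : ∀ r ∈ Icc R₁ R₂, 0 < ρ r) (ξ : ℝ) (W : ℝ → ℝ) : 0 ≤ E1fun R₁ R₂ ρ ξ W := by
  refine intervalIntegral.integral_nonneg hR₁₂.le fun r hr => ?_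
  have := hR₁.trans_le hr.1
  have := hρpos r hr
  positivity

theorem E1fun_eq {R₁ R₂ : ℝ} {ρ W : ℝ → ℝ} (hρ : Continuous ρ) (hW : ContDiff ℝ 2 W) (ξ : ℝ) :
    E1fun R₁ R₂ ρ ξ W = ξ ^ 2 * (∫ r in R₁..R₂, r * ρ r * (W r) ^ 2) +
      ∫ r in R₁..R₂, r * ρ r * (deriv (rW W) r) ^ 2 := by
  have h₀ := hW.continuous
  have h₁ := (contDiff_rW hW).continuous_deriv one_le_two
  rw [← intervalIntegral.integral_const_mul, ← intervalIntegral.integral_add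
    (Continuous.intervalIntegrable (by fun_prop) _ _)
    (Continuous.intervalIntegrable (by fun_prop) _ _), E1fun]
  simp only [mul_assoc]

theorem E2fun_eq {R₁ R₂ : ℝ} (μ α : ℝ) (hR₁ : 0 < R₁) (hR₁₂ : R₁ < R₂) {W : ℝ → ℝ}
    (hW : ContDiff ℝ 2 W) (ξ : ℝ) :
    E2fun R₁ R₂ μ α ξ W = (2 * ξ ^ 2 + 1) * (∫ r in R₁..R₂, r * (deriv W r) ^ 2) +
      (ξ ^ 2 - 1) ^ 2 * (∫ r in R₁..R₂, (W r) ^ 2 / r) +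
      (∫ r in R₁..R₂, r * (deriv (deriv (rW W)) r) ^ 2) +
      (1 - α / μ * R₁) * (deriv (rW W) R₁) ^ 2 := by
  have h₀ := hW.continuous
  have h₁ := hW.continuous_deriv one_le_two
  have h₂ := continuous_deriv_deriv_rW hW
  have hi₁ : IntervalIntegrable (fun r => (2 * ξ ^ 2 + 1) * (r * (deriv W r) ^ 2))
      volume R₁ R₂ := Continuous.intervalIntegrable (by fun_prop) _ _
  have hi₂ : IntervalIntegrable (fun r => (ξ ^ 2 - 1) ^ 2 * ((W r) ^ 2 / r))
      volume R₁ R₂ := by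
    refine ContinuousOn.intervalIntegrable (continuousOn_const.mul
      (ContinuousOn.div (by fun_prop) continuousOn_id fun r hr => ?_))
    rw [uIcc_of_le hR₁₂.le] at hr
    exact (hR₁.trans_le hr.1).ne'
  have hi₃ : IntervalIntegrable (fun r => r * (deriv (deriv (rW W)) r) ^ 2)
      volume R₁ R₂ := Continuous.intervalIntegrable (by fun_prop) _ _
  rw [← intervalIntegral.integral_const_mul, ← intervalIntegral.integral_const_mul,
    ← intervalIntegral.integral_add hi₁ hi₂, ← intervalIntegral.integral_add (hi₁.add hi₂) hi₃,
    E2fun]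
  congr 2
  ext r
  ring

theorem neg_mul_E1fun_le_E3fun {R₁ R₂ g K : ℝ} (hR₁ : 0 < R₁) (hR₁₂ : R₁ < R₂) (hg : 0 < g)
    {ρ W : ℝ → ℝ} (hρ : ContDiff ℝ 1 ρ) (hρpos : ∀ r ∈ Icc R₁ R₂, 0 < ρ r)
    (hW : ContDiff ℝ 2 W) (hK : 0 ≤ K) (hρK : ∀ r ∈ Icc R₁ R₂, deriv ρ r ≤ K * ρ r) (ξ : ℝ) :
    -(g * K) * E1fun R₁ R₂ ρ ξ W ≤ E3fun R₁ R₂ g ρ ξ W := by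
  have h₀ := hW.continuous
  have h₁ := hρ.continuous
  have h₂ := hρ.continuous_deriv_one
  have hmono : (∫ r in R₁..R₂, g * r * (W r) ^ 2 * deriv ρ r) ≤
      ∫ r in R₁..R₂, g * K * (r * ρ r * (W r) ^ 2) := by
    refine intervalIntegral.integral_mono_on hR₁₂.le
      (Continuous.intervalIntegrable (by fun_prop) _ _)
      (Continuous.intervalIntegrable (by fun_prop) _ _) fun r hr => ?_
    have : 0 < r := hR₁.trans_le hr.1
    calc g * r * (W r) ^ 2 * deriv ρ r ≤ g * r * (W r) ^ 2 * (K * ρ r) :=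
          mul_le_mul_of_nonneg_left (hρK r hr) (by positivity)
      _ = g * K * (r * ρ r * (W r) ^ 2) := by ring
  have hB : 0 ≤ ∫ r in R₁..R₂, r * ρ r * (deriv (rW W) r) ^ 2 := by
    refine intervalIntegral.integral_nonneg hR₁₂.le fun r hr => ?_
    have := hR₁.trans_le hr.1
    have := hρpos r hr
    positivity
  rw [intervalIntegral.integral_const_mul] at hmono
  rw [E1fun_eq h₁ hW, E3fun]
  nlinarith [mul_le_mul_of_nonneg_left hmono (sq_nonneg ξ),
    mul_nonneg (mul_nonneg hg.le hK) hB]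

theorem exists_deriv_le_mul {R₁ R₂ : ℝ} {ρ : ℝ → ℝ} (hρ : ContDiff ℝ 1 ρ)
    (hρpos : ∀ r ∈ Icc R₁ R₂, 0 < ρ r) :
    ∃ K : ℝ, 0 ≤ K ∧ ∀ r ∈ Icc R₁ R₂, deriv ρ r ≤ K * ρ r := by
  obtain ⟨K, hK⟩ := isCompact_Icc.exists_bound_of_continuousOn
    (hρ.continuous_deriv_one.continuousOn.div hρ.continuous.continuousOn
      fun r hr => (hρpos r hr).ne')
  refine ⟨max K 0, le_max_right _ _, fun r hr => ?_⟩
  rw [← div_le_iff₀ (hρpos r hr)]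
  exact (le_abs_self _).trans ((hK r hr).trans (le_max_left _ _))

theorem neg_mul_le_of_mem_PhiSet {R₁ R₂ μ α g K : ℝ} (hR₁ : 0 < R₁) (hR₁₂ : R₁ < R₂)
    (hμ : 0 < μ) (hg : 0 < g) (hα : 0 ≤ 1 - α * R₁ / μ) {ρ : ℝ → ℝ} (hρ : ContDiff ℝ 1 ρ)
    (hρpos : ∀ r ∈ Icc R₁ R₂, 0 < ρ r) (hK : 0 ≤ K)
    (hρK : ∀ r ∈ Icc R₁ R₂, deriv ρ r ≤ K * ρ r) {s ξ x : ℝ} (hs : 0 ≤ s)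
    (hx : x ∈ PhiSet R₁ R₂ μ α g ρ s ξ) : -(g * K) ≤ x := by
  obtain ⟨W, hW, -, rfl⟩ := hx
  have h₃ := neg_mul_E1fun_le_E3fun hR₁ hR₁₂ hg hρ hρpos hW.1 hK hρK ξ
  have h₂ := mul_nonneg (mul_nonneg hμ.le hs) (E2fun_nonneg hR₁ hR₁₂ hα ξ W)
  rcases (E1fun_nonneg hR₁ hR₁₂ hρpos ξ W).eq_or_lt with h | h
  · rw [← h, div_zero, neg_nonpos]
    positivity
  · rw [le_div_iff₀ h, Efun]
    linarith

/-- An admissible profile that is positive in the interior of the interval. -/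
def cubicProfile (R₁ R₂ : ℝ) : ℝ → ℝ := fun r => (r - R₁) * (r - R₂) ^ 2

theorem admW_cubicProfile (R₁ R₂ : ℝ) : AdmW R₁ R₂ (cubicProfile R₁ R₂) := by
  refine ⟨by unfold cubicProfile; fun_prop, by simp [cubicProfile], by simp [cubicProfile], ?_⟩
  have h := ((hasDerivAt_id R₂).sub_const R₁).mul (((hasDerivAt_id R₂).sub_const R₂).pow 2)
  exact (HasDerivAt.deriv (f := cubicProfile R₁ R₂) h).trans (by simp)

theorem cubicProfile_pos {R₁ R₂ r : ℝ} (hr : r ∈ Ioo R₁ R₂) : 0 < cubicProfile R₁ R₂ r :=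
  mul_pos (sub_pos.2 hr.1) (sq_pos_of_ne_zero (sub_ne_zero.2 hr.2.ne))

theorem E1fun_cubicProfile_pos {R₁ R₂ : ℝ} (hR₁ : 0 < R₁) (hR₁₂ : R₁ < R₂) {ρ : ℝ → ℝ}
    (hρ : Continuous ρ) (hρpos : ∀ r ∈ Icc R₁ R₂, 0 < ρ r) {ξ : ℝ} (hξ : ξ ≠ 0) :
    0 < E1fun R₁ R₂ ρ ξ (cubicProfile R₁ R₂) := by
  have hW := (admW_cubicProfile R₁ R₂).1
  have h₀ := hW.continuous
  have h₁ := (contDiff_rW hW).continuous_deriv one_le_two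
  refine intervalIntegral.intervalIntegral_pos_of_pos_on
    (Continuous.intervalIntegrable (by fun_prop) _ _) (fun r hr => ?_) hR₁₂
  have := hR₁.trans hr.1
  have := hρpos r (Ioo_subset_Icc_self hr)
  have := cubicProfile_pos hr
  positivity

theorem continuous_E1fun {R₁ R₂ : ℝ} {ρ W : ℝ → ℝ} (hρ : Continuous ρ)
    (hW : ContDiff ℝ 2 W) : Continuous fun ξ => E1fun R₁ R₂ ρ ξ W := by
  simp only [E1fun_eq hρ hW]
  fun_prop

theorem continuous_Efun {R₁ R₂ : ℝ} (μ α g : ℝ) (hR₁ : 0 < R₁) (hR₁₂ : R₁ < R₂) (ρ : ℝ → ℝ)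
    {W : ℝ → ℝ} (hW : ContDiff ℝ 2 W) :
    Continuous fun p : ℝ × ℝ => Efun R₁ R₂ μ α g ρ p.1 p.2 W := by
  simp only [Efun, E2fun_eq μ α hR₁ hR₁₂ hW, E3fun]
  fun_prop

theorem statement9 (R₁ R₂ μ α g : ℝ) (hR₁ : 0 < R₁) (hR₁₂ : R₁ < R₂) (hμ : 0 < μ)
    (hg : 0 < g) (hα : 0 ≤ 1 - α * R₁ / μ) (ρ : ℝ → ℝ) (hρ : ContDiff ℝ (⊤ : ℕ∞) ρ)
    (hρpos : ∀ r ∈ Icc R₁ R₂, 0 < ρ r) :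
    ∀ a b c d : ℝ, 0 < a → a ≤ b → 0 < c → c ≤ d →
      ∃ M : ℝ, 0 < M ∧
        ∀ s ∈ Icc a b, ∀ ξ ∈ Icc c d, |Phi R₁ R₂ μ α g ρ s ξ| ≤ M := by
  intro a b c d ha _ hc _
  have hρ₁ : ContDiff ℝ 1 ρ := hρ.of_le (by exact_mod_cast le_top)
  obtain ⟨K, hK, hρK⟩ := exists_deriv_le_mul hρ₁ hρpos
  have hW := admW_cubicProfile R₁ R₂
  obtain ⟨C, hC⟩ := (isCompact_Icc.prod isCompact_Icc :
    IsCompact (Icc a b ×ˢ Icc c d)).exists_bound_of_continuousOn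
      ((continuous_Efun μ α g hR₁ hR₁₂ ρ hW.1).continuousOn.div
        ((continuous_E1fun (R₁ := R₁) (R₂ := R₂) hρ₁.continuous hW.1).comp
          continuous_snd).continuousOn
        fun p hp => (E1fun_cubicProfile_pos hR₁ hR₁₂ hρ₁.continuous hρpos
          (hc.trans_le hp.2.1).ne').ne')
  refine ⟨max C (g * K) + 1, by
    have := le_max_right C (g * K)
    have : 0 ≤ g * K := by positivity
    linarith, fun s hs ξ hξ => ?_⟩
  have hlow : ∀ x ∈ PhiSet R₁ R₂ μ α g ρ s ξ, -(g * K) ≤ x := fun x hx =>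
    neg_mul_le_of_mem_PhiSet hR₁ hR₁₂ hμ hg hα hρ₁ hρpos hK hρK (ha.le.trans hs.1) hx
  obtain ⟨r, hr⟩ := nonempty_Ioo.2 hR₁₂
  have hmem : Efun R₁ R₂ μ α g ρ s ξ (cubicProfile R₁ R₂) /
      E1fun R₁ R₂ ρ ξ (cubicProfile R₁ R₂) ∈ PhiSet R₁ R₂ μ α g ρ s ξ :=
    ⟨_, hW, ⟨r, Ioo_subset_Icc_self hr, (cubicProfile_pos hr).ne'⟩, rfl⟩
  have h₁ : -(g * K) ≤ Phi R₁ R₂ μ α g ρ s ξ := le_csInf ⟨_, hmem⟩ hlow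
  have h₂ : Phi R₁ R₂ μ α g ρ s ξ ≤ C :=
    (csInf_le ⟨_, hlow⟩ hmem).trans ((le_abs_self _).trans (hC (s, ξ) ⟨hs, hξ⟩))
  rw [abs_le]
  constructor <;> linarith [le_max_left C (g * K), le_max_right C (g * K)]

end
end
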